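/- Let r and k be integers with 0 < r < k and let q be a complex number with |q| < 1. Then ∑_{n=0}^{∞} q^{rn} q^{k(n²+n)} / (q^k; q^k)_n = (−q^{r+2k}; q^{2k})_∞ · ∑_{n=0}^{∞} q^{rn} q^{k(n²+2n)} / ((q^{2k}; q^{2k})_n · (−q^{r+2k}; q^{2k})_n). -/

import Mathlib

/-- The finite q-Pochhammer symbol `(a; q)_n = ∏_{j=0}^{n-1} (1 - a q^j)`. -/
noncomputable def qPoch (a q : ℂ) (n : ℕ) : ℂ := ∏ j ∈ Finset.range n, (1 - a * q ^ j)

/-- The infinite q-Pochhammer symbol `(a; q)_∞ = ∏_{j=0}^{∞} (1 - a q^j)`. -/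
noncomputable def qPochInf (a q : ℂ) : ℂ := ∏' j : ℕ, (1 - a * q ^ j)

theorem qPoch_succ (a q : ℂ) (n : ℕ) : qPoch a q (n + 1) = qPoch a q n * (1 - a * q ^ n) := by
  simp [qPoch, Finset.prod_range_succ]

theorem qPoch_ne_zero {a q : ℂ} (ha : ‖a‖ < 1) (hq : ‖q‖ < 1) (n : ℕ) : qPoch a q n ≠ 0 := by
  refine Finset.prod_ne_zero_iff.2 fun j _ h => ?_
  have h1 : ‖a * q ^ j‖ = 1 := by rw [← sub_eq_zero.1 h, norm_one]
  rw [norm_mul, norm_pow] at h1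
  have h2 : ‖a‖ * ‖q‖ ^ j ≤ ‖a‖ :=
    mul_le_of_le_one_right (norm_nonneg _) (pow_le_one₀ (norm_nonneg _) hq.le)
  linarith

theorem one_sub_pow_succ_ne_zero {q : ℂ} (hq : ‖q‖ < 1) (n : ℕ) : 1 - q ^ (n + 1) ≠ 0 := by
  intro h
  have h1 : ‖q‖ ^ (n + 1) = 1 := by rw [← norm_pow, ← sub_eq_zero.1 h, norm_one]
  exact (pow_lt_one₀ (norm_nonneg q) hq n.succ_ne_zero).ne h1

theorem multipliable_qPochInf (a : ℂ) {q : ℂ} (hq : ‖q‖ < 1) :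
    Multipliable fun j : ℕ => 1 - a * q ^ j := by
  have h : Summable fun j : ℕ => ‖-(a * q ^ j)‖ := by
    simpa [norm_mul, norm_pow] using
      (summable_geometric_of_lt_one (norm_nonneg q) hq).mul_left ‖a‖
  simpa [sub_eq_add_neg] using multipliable_one_add_of_summable h

theorem qPochInf_eq_qPoch_mul (a : ℂ) {q : ℂ} (hq : ‖q‖ < 1) (n : ℕ) :
    qPochInf a q = qPoch a q n * qPochInf (a * q ^ n) q := by
  have h := multipliable_qPochInf (a * q ^ n) hq
  have e : (fun j : ℕ => 1 - a * q ^ n * q ^ j) = fun j => 1 - a * q ^ (j + n) := by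
    ext j; ring
  rw [e] at h
  rw [qPochInf, qPochInf, e, qPoch]
  exact (Multipliable.prod_mul_tprod_nat_mul' (f := fun j => 1 - a * q ^ j) h).symm

/-- The general term of Euler's expansion of `(-z; q)_∞`. -/
noncomputable def eulerTerm (q z : ℂ) (m : ℕ) : ℂ := q ^ m.choose 2 * z ^ m / qPoch q q m

theorem eulerTerm_zero (q z : ℂ) : eulerTerm q z 0 = 1 := by
  simp [eulerTerm, qPoch]

theorem eulerTerm_succ (q z : ℂ) (m : ℕ) :
    eulerTerm q z (m + 1) = q ^ m * z / (1 - q ^ (m + 1)) * eulerTerm q z m := by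
  rw [eulerTerm, eulerTerm, qPoch_succ, Nat.choose_succ_succ' m 1, Nat.choose_one_right,
    div_mul_div_comm, ← pow_succ']
  ring

theorem eulerTerm_mul (q z w : ℂ) (m : ℕ) : eulerTerm q (z * w) m = w ^ m * eulerTerm q z m := by
  rw [eulerTerm, eulerTerm]; ring

theorem summable_eulerTerm {q : ℂ} (hq : ‖q‖ < 1) (z : ℂ) : Summable (eulerTerm q z) := by
  have h0 := tendsto_pow_atTop_nhds_zero_of_norm_lt_one hq
  have h : Filter.Tendsto (fun m : ℕ => ‖q ^ m * z / (1 - q ^ (m + 1))‖) Filter.atTop (nhds 0) := by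
    have h1 := (h0.mul_const z).div
      (((Filter.tendsto_add_atTop_iff_nat 1).2 h0).const_sub 1) (by simp)
    simpa using h1.norm
  refine summable_of_ratio_norm_eventually_le (r := 1 / 2) (by norm_num) ?_
  filter_upwards [h.eventually_le_const (show (0 : ℝ) < 1 / 2 by norm_num)] with m hm
  rw [eulerTerm_succ, norm_mul]
  gcongr

theorem tsum_eulerTerm_step {q : ℂ} (hq : ‖q‖ < 1) (z : ℂ) :
    ∑' m, eulerTerm q z m = (1 + z) * ∑' m, eulerTerm q (z * q) m := by
  have h1 := summable_eulerTerm hq z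
  have h2 := summable_eulerTerm hq (z * q)
  have h3 : ∑' m, eulerTerm q z m - ∑' m, eulerTerm q (z * q) m
      = z * ∑' m, eulerTerm q (z * q) m := by
    rw [← h1.tsum_sub h2, (h1.sub h2).tsum_eq_zero_add, ← tsum_mul_left]
    simp only [eulerTerm_zero, sub_self, zero_add]
    refine tsum_congr fun m => ?_
    have := one_sub_pow_succ_ne_zero hq m
    rw [eulerTerm_mul, eulerTerm_mul, eulerTerm_succ]
    field_simp
  linear_combination h3

theorem tsum_eulerTerm_iterate {q : ℂ} (hq : ‖q‖ < 1) (z : ℂ) (n : ℕ) :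
    ∑' m, eulerTerm q z m = qPoch (-z) q n * ∑' m, eulerTerm q (z * q ^ n) m := by
  induction n with
  | zero => simp [qPoch]
  | succ n ih =>
    rw [ih, tsum_eulerTerm_step hq (z * q ^ n), qPoch_succ, pow_succ, ← mul_assoc z]
    ring

/-- Euler's expansion of `(-z; q)_∞`. -/
theorem tsum_eulerTerm {q : ℂ} (hq : ‖q‖ < 1) (z : ℂ) :
    ∑' m, eulerTerm q z m = qPochInf (-z) q := by
  have h1 : Filter.Tendsto (fun n => qPoch (-z) q n) Filter.atTop (nhds (qPochInf (-z) q)) :=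
    (multipliable_qPochInf (-z) hq).hasProd.tendsto_prod_nat
  have h2 : Filter.Tendsto (fun n : ℕ => ∑' m, eulerTerm q (z * q ^ n) m) Filter.atTop
      (nhds (∑' m, eulerTerm q (z * 0) m)) := by
    refine tendsto_tsum_of_dominated_convergence (summable_eulerTerm hq z).norm (fun m => ?_) ?_
    · simp only [eulerTerm_mul]
      exact ((tendsto_pow_atTop_nhds_zero_of_norm_lt_one hq).pow m).mul_const _
    · refine Filter.Eventually.of_forall fun n m => ?_
      rw [eulerTerm_mul, norm_mul, norm_pow, norm_pow]
      exact mul_le_of_le_one_left (norm_nonneg _)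
        (pow_le_one₀ (by positivity) (pow_le_one₀ (norm_nonneg _) hq.le))
  have h3 : ∑' m, eulerTerm q (z * 0) m = 1 := by
    rw [tsum_eq_single 0, eulerTerm_zero]
    intro m hm
    simp [eulerTerm, hm]
  rw [h3] at h2
  have h4 := h1.mul h2
  simp only [← tsum_eulerTerm_iterate hq z, mul_one] at h4
  exact tendsto_nhds_unique tendsto_const_nhds h4

theorem inv_qPoch_succ {q : ℂ} (hq : ‖q‖ < 1) (n : ℕ) :
    (1 - q ^ (n + 1)) * (qPoch q q (n + 1))⁻¹ = (qPoch q q n)⁻¹ := by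
  have h1 := one_sub_pow_succ_ne_zero hq n
  have h2 := qPoch_ne_zero hq hq n
  rw [qPoch_succ, ← pow_succ']
  field_simp

open Finset in
/-- The convolution of `zⁿ / (q; q)_n` with `1 / (q; q)_n`, weighted by powers `wⁿ`. -/
theorem sum_antidiagonal_one_sub_pow_mul {q : ℂ} (hq : ‖q‖ < 1) (z : ℂ) (N : ℕ) :
    ∑ x ∈ antidiagonal (N + 1),
        (1 - q ^ x.1) * (z ^ x.1 * (qPoch q q x.1)⁻¹ * (qPoch q q x.2)⁻¹) =
      z * ∑ x ∈ antidiagonal N, z ^ x.1 * (qPoch q q x.1)⁻¹ * (qPoch q q x.2)⁻¹ := by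
  rw [Nat.sum_antidiagonal_succ, mul_sum]
  simp only [pow_zero, sub_self, zero_mul, zero_add]
  refine sum_congr rfl fun x _ => ?_
  rw [← inv_qPoch_succ hq x.1]
  ring

open Finset in
theorem sum_antidiagonal_pow_mul_one_sub_pow {q : ℂ} (hq : ‖q‖ < 1) (z : ℂ) (N : ℕ) :
    ∑ x ∈ antidiagonal (N + 1),
        (1 - q ^ x.2) * ((z * q) ^ x.1 * (qPoch q q x.1)⁻¹ * (qPoch q q x.2)⁻¹) =
      ∑ x ∈ antidiagonal N, (z * q) ^ x.1 * (qPoch q q x.1)⁻¹ * (qPoch q q x.2)⁻¹ := by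
  rw [Nat.sum_antidiagonal_succ']
  simp only [pow_zero, sub_self, zero_mul, zero_add]
  refine sum_congr rfl fun x _ => ?_
  rw [← inv_qPoch_succ hq x.2]
  ring

open Finset in
/-- `∑ pⁿ / ((p²; p²)_n (p²; p²)_{N-n}) = 1 / (p; p)_N`, with the companion sum in `p³ⁿ`. -/
theorem sum_antidiagonal_qPoch_sq {p : ℂ} (hp : ‖p‖ < 1) (N : ℕ) :
    ∑ x ∈ antidiagonal N, p ^ x.1 * (qPoch (p ^ 2) (p ^ 2) x.1)⁻¹ * (qPoch (p ^ 2) (p ^ 2) x.2)⁻¹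
        = (qPoch p p N)⁻¹ ∧
    ∑ x ∈ antidiagonal N,
        (p * p ^ 2) ^ x.1 * (qPoch (p ^ 2) (p ^ 2) x.1)⁻¹ * (qPoch (p ^ 2) (p ^ 2) x.2)⁻¹
        = (1 - p * (1 - p ^ N)) * (qPoch p p N)⁻¹ := by
  have hp2 : ‖p ^ 2‖ < 1 := by
    rw [norm_pow]; exact pow_lt_one₀ (norm_nonneg _) hp two_ne_zero
  induction N with
  | zero => simp [qPoch]
  | succ N ih =>
    obtain ⟨ihS, ihT⟩ := ih
    have hA := sum_antidiagonal_one_sub_pow_mul hp2 p N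
    have hB := sum_antidiagonal_pow_mul_one_sub_pow hp2 p N
    rw [ihS] at hA
    rw [ihT] at hB
    have hne := one_sub_pow_succ_ne_zero hp2 N
    have hI := inv_qPoch_succ hp N
    have hS : ∑ x ∈ antidiagonal (N + 1),
        p ^ x.1 * (qPoch (p ^ 2) (p ^ 2) x.1)⁻¹ * (qPoch (p ^ 2) (p ^ 2) x.2)⁻¹
        = (qPoch p p (N + 1))⁻¹ := by
      refine mul_left_cancel₀ hne ?_
      have h := congrArg₂ (· + ·) hA hB
      simp only [← sum_add_distrib] at h
      rw [mul_sum]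
      refine Eq.trans (sum_congr rfl fun x hx => ?_) (h.trans ?_)
      · rw [← mem_antidiagonal.1 hx]
        ring
      · rw [← hI]
        ring
    refine ⟨hS, ?_⟩
    have h : ∑ x ∈ antidiagonal (N + 1),
        (p * p ^ 2) ^ x.1 * (qPoch (p ^ 2) (p ^ 2) x.1)⁻¹ * (qPoch (p ^ 2) (p ^ 2) x.2)⁻¹
        = (qPoch p p (N + 1))⁻¹ - p * (qPoch p p N)⁻¹ := by
      rw [← hS, ← hA, ← sum_sub_distrib]
      refine sum_congr rfl fun x _ => ?_
      ring
    rw [h, ← hI]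
    ring

theorem two_mul_choose_two_add (n : ℕ) : 2 * n.choose 2 + n = n ^ 2 := by
  induction n with
  | zero => rfl
  | succ n ih =>
    rw [Nat.choose_succ_succ' n 1, Nat.choose_one_right]
    linarith

theorem tsum_prod_eq_tsum_sum_antidiagonal {f : ℕ × ℕ → ℂ} (hf : Summable f) :
    ∑' n, ∑' m, f (n, m) = ∑' N, ∑ x ∈ Finset.HasAntidiagonal.antidiagonal N, f x := by
  rw [← hf.tsum_prod, ← Finset.HasAntidiagonal.sigmaAntidiagonalEquivProd.tsum_eq f]
  have h := (Finset.HasAntidiagonal.sigmaAntidiagonalEquivProd.summable_iff (f := f)).2 hf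
  refine h.tsum_sigma.trans (tsum_congr fun N => ?_)
  rw [tsum_fintype]
  exact Finset.sum_coe_sort (Finset.HasAntidiagonal.antidiagonal N) f

theorem tsum_eq_qPochInf_mul_tsum {x p : ℂ} (hx : ‖x‖ < 1) (hp : ‖p‖ < 1) :
    ∑' n : ℕ, x ^ n * p ^ (n ^ 2 + n) / qPoch p p n =
      qPochInf (-(x * p ^ 2)) (p ^ 2) *
        ∑' n : ℕ, x ^ n * p ^ (n ^ 2 + 2 * n) /
          (qPoch (p ^ 2) (p ^ 2) n * qPoch (-(x * p ^ 2)) (p ^ 2) n) := by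
  have hp2 : ‖p ^ 2‖ < 1 := by
    rw [norm_pow]; exact pow_lt_one₀ (norm_nonneg _) hp two_ne_zero
  have hxp : ‖-(x * p ^ 2)‖ < 1 := by
    rw [norm_neg, norm_mul]
    exact mul_lt_one_of_nonneg_of_lt_one_left (norm_nonneg _) hx hp2.le
  let f : ℕ × ℕ → ℂ := fun y => x ^ (y.1 + y.2) * p ^ ((y.1 + y.2) ^ 2 + (y.1 + y.2)) *
    (p ^ y.1 * (qPoch (p ^ 2) (p ^ 2) y.1)⁻¹ * (qPoch (p ^ 2) (p ^ 2) y.2)⁻¹)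
  have hf : Summable f := by
    have h := (summable_eulerTerm hp2 x).norm
    refine Summable.of_norm_bounded
      (h.mul_of_nonneg h (fun _ => norm_nonneg _) fun _ => norm_nonneg _) fun y => ?_
    have e : f y = p ^ (2 * y.1 * y.2 + 3 * y.1 + 2 * y.2) *
        (eulerTerm (p ^ 2) x y.1 * eulerTerm (p ^ 2) x y.2) := by
      have e1 : (y.1 + y.2) ^ 2 + (y.1 + y.2) + y.1 =
          (2 * y.1 * y.2 + 3 * y.1 + 2 * y.2) + 2 * y.1.choose 2 + 2 * y.2.choose 2 := by
        linarith [two_mul_choose_two_add y.1, two_mul_choose_two_add y.2]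
      calc f y = x ^ (y.1 + y.2) * p ^ ((y.1 + y.2) ^ 2 + (y.1 + y.2) + y.1) *
            ((qPoch (p ^ 2) (p ^ 2) y.1)⁻¹ * (qPoch (p ^ 2) (p ^ 2) y.2)⁻¹) := by
              simp only [f]; rw [pow_add p _ y.1]; ring
        _ = _ := by
              rw [e1, eulerTerm, eulerTerm, ← pow_mul, ← pow_mul, pow_add p, pow_add p]; ring
    rw [e, norm_mul, norm_mul, norm_pow]
    exact mul_le_of_le_one_left (by positivity) (pow_le_one₀ (norm_nonneg _) hp.le)
  have key := tsum_prod_eq_tsum_sum_antidiagonal hf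
  rw [← tsum_mul_left]
  refine Eq.trans (tsum_congr fun N => ?_) (key.symm.trans (tsum_congr fun n => ?_))
  · rw [div_eq_mul_inv, ← (sum_antidiagonal_qPoch_sq hp N).1, Finset.mul_sum]
    refine Finset.sum_congr rfl fun y hy => ?_
    rw [← Finset.HasAntidiagonal.mem_antidiagonal.1 hy]
  · have h1 := qPoch_ne_zero hxp hp2 n
    have h2 := qPoch_ne_zero hp2 hp2 n
    rw [qPochInf_eq_qPoch_mul _ hp2 n, neg_mul, ← tsum_eulerTerm hp2]
    have e : ∀ S : ℂ, qPoch (-(x * p ^ 2)) (p ^ 2) n * S * (x ^ n * p ^ (n ^ 2 + 2 * n) /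
        (qPoch (p ^ 2) (p ^ 2) n * qPoch (-(x * p ^ 2)) (p ^ 2) n)) =
        x ^ n * p ^ (n ^ 2 + 2 * n) / qPoch (p ^ 2) (p ^ 2) n * S := fun S => by field_simp
    rw [e, ← tsum_mul_left]
    refine tsum_congr fun m => ?_
    have e1 : (n + m) ^ 2 + (n + m) + n = (n ^ 2 + 2 * n) + 2 * m.choose 2 + 2 * m + 2 * n * m := by
      linarith [two_mul_choose_two_add m]
    calc f (n, m) = x ^ (n + m) * p ^ ((n + m) ^ 2 + (n + m) + n) *
          ((qPoch (p ^ 2) (p ^ 2) n)⁻¹ * (qPoch (p ^ 2) (p ^ 2) m)⁻¹) := by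
            simp only [f]; rw [pow_add p _ n]; ring
      _ = _ := by
            rw [e1, eulerTerm, pow_add p, pow_add p, pow_add p, mul_pow, mul_pow, ← pow_mul,
              ← pow_mul, ← pow_mul, ← pow_mul]
            ring

/-- for integers `0 < r < k` and `|q| < 1`,
`∑_{n≥0} q^{rn} q^{k(n²+n)}/(q^k; q^k)_n
  = (−q^{r+2k}; q^{2k})_∞ ∑_{n≥0} q^{rn} q^{k(n²+2n)}/((q^{2k}; q^{2k})_n (−q^{r+2k}; q^{2k})_n)`. -/
theorem restricted_entry_1_5_1 (r k : ℕ) (hr : 0 < r) (hrk : r < k)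
    (q : ℂ) (hq : ‖q‖ < 1) :
    ∑' n : ℕ, q ^ (r * n) * q ^ (k * (n ^ 2 + n)) / qPoch (q ^ k) (q ^ k) n =
      qPochInf (-q ^ (r + 2 * k)) (q ^ (2 * k)) *
        ∑' n : ℕ, q ^ (r * n) * q ^ (k * (n ^ 2 + 2 * n)) /
          (qPoch (q ^ (2 * k)) (q ^ (2 * k)) n * qPoch (-q ^ (r + 2 * k)) (q ^ (2 * k)) n) := by
  have hpow : ∀ j : ℕ, 0 < j → ‖q ^ j‖ < 1 := fun j hj => by
    rw [norm_pow]; exact pow_lt_one₀ (norm_nonneg _) hq hj.ne'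
  have h := tsum_eq_qPochInf_mul_tsum (hpow r hr) (hpow k (hr.trans hrk))
  have e1 : q ^ (r + 2 * k) = q ^ r * (q ^ k) ^ 2 := by ring
  have e2 : q ^ (2 * k) = (q ^ k) ^ 2 := by ring
  simp only [e1, e2, pow_mul q r, pow_mul q k]
  exact h
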